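/- For every 0 < α < 1 there exists a constant C > 0 such that the following holds: for every z ∈ ℤ² with ‖z‖ ≥ 1/α and every n ∈ ℕ with n > ‖z‖⁴, the simple random walk on ℤ² started at z satisfies P_z[ T_{α‖z‖} ≥ n ] ≤ C / log( n / ‖z‖⁴ ), where T_{α‖z‖} = inf{ t ≥ 0 : ‖S(t)‖ ≤ α‖z‖ }. -/

import Mathlib

open Real

/-- A single step of the simple random walk on `ℤ^d`: the pair `(i, b)` encodes a move by
`+eᵢ` (if `b = true`) or `-eᵢ` (if `b = false`).  The uniform distribution on `Fin d × Bool`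
corresponds to the uniform distribution on the `2d` unit vectors. -/
def step {d : ℕ} (a : Fin d × Bool) : Fin d → ℤ :=
  fun j => if j = a.1 then (if a.2 then 1 else -1) else 0

/-- The position `S(k)` of the walk started at `z` after `k` steps, driven by the
sequence of i.i.d. uniform steps `ω : Fin n → Fin d × Bool` (meaningful for `k ≤ n`). -/
def walk {d n : ℕ} (z : Fin d → ℤ) (ω : Fin n → Fin d × Bool) (k : ℕ) : Fin d → ℤ :=
  z + ∑ i ∈ Finset.univ.filter (fun i : Fin n => (i : ℕ) < k), step (ω i)

/-- Probability of an event for the `n`-step simple random walk on `ℤ^d`: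
the driving step sequences are uniform among the `(2d)^n` possibilities. -/
noncomputable def prW (d n : ℕ) (E : Set (Fin n → Fin d × Bool)) : ℝ :=
  E.ncard / (2 * d) ^ n

/-- Expectation of a random variable of the `n`-step simple random walk on `ℤ^d`. -/
noncomputable def exW (d n : ℕ) (f : (Fin n → Fin d × Bool) → ℝ) : ℝ :=
  (∑ ω : Fin n → Fin d × Bool, f ω) / (2 * d) ^ n

/-- Shannon entropy (base 2) of a random variable `X` of the `n`-step walk:
`H(X) = ∑ₐ -P[X = a] · log₂ P[X = a]`. -/
noncomputable def entW {α : Type*} (d n : ℕ) (X : (Fin n → Fin d × Bool) → α) : ℝ :=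
  ∑' a : α, -(prW d n {ω | X ω = a} * logb 2 (prW d n {ω | X ω = a}))

/-- The range `R(n) = {S(0), …, S(n)}` of the `n`-step walk started at `z`. -/
def rangeW {d n : ℕ} (z : Fin d → ℤ) (ω : Fin n → Fin d × Bool) : Finset (Fin d → ℤ) :=
  (Finset.range (n + 1)).image (walk z ω)

/-- The inner boundary `∂A` of a finite set `A ⊆ ℤ^d`: the points of `A` adjacent
(at graph distance 1, i.e. reachable by a single step) to some vertex of the complement. -/
def innerBdry {d : ℕ} (A : Finset (Fin d → ℤ)) : Finset (Fin d → ℤ) :=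
  A.filter fun x => ∃ a : Fin d × Bool, x + step a ∉ A

/-- The Euclidean (`L²`) norm on `ℤ^d`. -/
noncomputable def eNorm {d : ℕ} (x : Fin d → ℤ) : ℝ :=
  Real.sqrt (∑ i, ((x i : ℝ)) ^ 2)

/-- The squared Euclidean norm on `ℤ²`. -/
noncomputable def normSq₂ (x : Fin 2 → ℤ) : ℝ := (x 0 : ℝ) ^ 2 + (x 1 : ℝ) ^ 2

lemma eNorm_sq (x : Fin 2 → ℤ) : eNorm x ^ 2 = normSq₂ x := by
  unfold eNorm normSq₂
  rw [Real.sq_sqrt (Finset.sum_nonneg fun i _ => sq_nonneg _), Fin.sum_univ_two]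

lemma one_le_normSq₂_of_pos {x : Fin 2 → ℤ} (hx : 0 < normSq₂ x) : 1 ≤ normSq₂ x := by
  unfold normSq₂ at *
  have h : 0 < x 0 ^ 2 + x 1 ^ 2 := by exact_mod_cast hx
  have h' : 1 ≤ x 0 ^ 2 + x 1 ^ 2 := h
  exact_mod_cast h'

lemma normSq₂_step (a : Fin 2 × Bool) : normSq₂ (step a) = 1 := by
  obtain ⟨i, b⟩ := a
  fin_cases i <;> cases b <;> simp [normSq₂, step]

lemma normSq₂_add_le (x y : Fin 2 → ℤ) : normSq₂ (x + y) ≤ 2 * normSq₂ x + 2 * normSq₂ y := by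
  simp only [normSq₂, Pi.add_apply, Int.cast_add]
  nlinarith [sq_nonneg ((x 0 : ℝ) - y 0), sq_nonneg ((x 1 : ℝ) - y 1)]

lemma normSq₂_neg (x : Fin 2 → ℤ) : normSq₂ (-x) = normSq₂ x := by
  simp [normSq₂]

lemma normSq₂_add_step_le (x : Fin 2 → ℤ) (a : Fin 2 × Bool) :
    normSq₂ (x + step a) ≤ 2 * normSq₂ x + 2 := by
  have h := normSq₂_add_le x (step a)
  rw [normSq₂_step] at h
  linarith

lemma normSq₂_le_add_step (x : Fin 2 → ℤ) (a : Fin 2 × Bool) :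
    normSq₂ x ≤ 2 * normSq₂ (x + step a) + 2 := by
  have h := normSq₂_add_le (x + step a) (-step a)
  rw [normSq₂_neg, normSq₂_step, add_neg_cancel_right] at h
  linarith

lemma one_le_normSq₂_add_step {x : Fin 2 → ℤ} (hx : 1 < normSq₂ x) (a : Fin 2 × Bool) :
    1 ≤ normSq₂ (x + step a) := by
  apply one_le_normSq₂_of_pos
  by_contra! h
  unfold normSq₂ at h
  have h0 : (x + step a) 0 = 0 := by
    have : (((x + step a) 0 : ℤ) : ℝ) = 0 := by
      nlinarith [sq_nonneg (((x + step a) 0 : ℤ) : ℝ), sq_nonneg (((x + step a) 1 : ℤ) : ℝ)]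
    exact_mod_cast this
  have h1 : (x + step a) 1 = 0 := by
    have : (((x + step a) 1 : ℤ) : ℝ) = 0 := by
      nlinarith [sq_nonneg (((x + step a) 0 : ℤ) : ℝ), sq_nonneg (((x + step a) 1 : ℤ) : ℝ)]
    exact_mod_cast this
  have hs : x + step a = 0 := by
    ext i
    fin_cases i
    · exact h0
    · exact h1
  rw [eq_neg_of_add_eq_zero_left hs, normSq₂_neg, normSq₂_step] at hx
  exact lt_irrefl _ hx

/-- Sums over the four directions of a function of the squared norm. -/
lemma sum_normSq₂_add_step (f : ℝ → ℝ) (x : Fin 2 → ℤ) :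
    ∑ a, f (normSq₂ (x + step a)) =
      f (normSq₂ x + 1 + 2 * x 0) + f (normSq₂ x + 1 - 2 * x 0) +
        (f (normSq₂ x + 1 + 2 * x 1) + f (normSq₂ x + 1 - 2 * x 1)) := by
  rw [Fintype.sum_prod_type, Fin.sum_univ_two, Fintype.sum_bool, Fintype.sum_bool]
  congr 2 <;> congr 1 <;> simp [normSq₂, step] <;> ring

/-- `x ↦ log (2‖x‖² - 1)` is superharmonic for the walk outside the unit ball. -/
lemma sum_log_add_step_le {x : Fin 2 → ℤ} (hx : 1 < normSq₂ x) :
    ∑ a, log (2 * normSq₂ (x + step a) - 1) ≤ 4 * log (2 * normSq₂ x - 1) := by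
  have hpos : ∀ a, 0 < 2 * normSq₂ (x + step a) - 1 := fun a => by
    linarith [one_le_normSq₂_add_step hx a]
  rw [← Real.log_prod fun a _ => (hpos a).ne']
  have h4 : 4 * log (2 * normSq₂ x - 1) = log ((2 * normSq₂ x - 1) ^ 4) := by
    rw [Real.log_pow]; norm_num
  rw [h4]
  apply Real.log_le_log (Finset.prod_pos fun a _ => hpos a)
  rw [Fintype.prod_prod_type, Fin.prod_univ_two, Fintype.prod_bool, Fintype.prod_bool]
  simp only [normSq₂, step, Pi.add_apply]
  simp
  nlinarith [sq_nonneg ((x 0 : ℝ) ^ 2 - (x 1 : ℝ) ^ 2)]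

lemma walk_zero {d n : ℕ} (z : Fin d → ℤ) (ω : Fin n → Fin d × Bool) : walk z ω 0 = z := by
  simp [walk]

lemma walk_cons_succ {d n : ℕ} (z : Fin d → ℤ) (a : Fin d × Bool) (ω : Fin n → Fin d × Bool)
    (t : ℕ) : walk z (Fin.cons a ω : Fin (n + 1) → Fin d × Bool) (t + 1) =
      walk (z + step a) ω t := by
  simp [walk, Finset.sum_filter, Fin.sum_univ_succ, add_assoc]

lemma prW_le_one (d n : ℕ) [NeZero d] (E : Set (Fin n → Fin d × Bool)) : prW d n E ≤ 1 := by
  have hd : (0 : ℝ) < d := by exact_mod_cast NeZero.pos d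
  unfold prW
  rw [div_le_one (by positivity)]
  have h := Set.ncard_le_ncard (Set.subset_univ E)
  rw [Set.ncard_univ, Nat.card_eq_fintype_card] at h
  simp only [Fintype.card_fun, Fintype.card_prod, Fintype.card_fin, Fintype.card_bool] at h
  rw [mul_comm (2 : ℝ)]
  exact_mod_cast h

/-- The Markov property at time one. -/
lemma prW_forall_succ_le (d m : ℕ) (p : (Fin d → ℤ) → Prop) (x : Fin d → ℤ) :
    prW d (m + 1) {ω | ∀ t < m + 1, p (walk x ω t)} ≤
      (∑ a, prW d m {ω | ∀ t < m, p (walk (x + step a) ω t)}) / (2 * d) := by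
  unfold prW
  rw [← Finset.sum_div, div_div, ← pow_succ]
  apply div_le_div_of_nonneg_right _ (by positivity)
  have hsub : {ω : Fin (m + 1) → Fin d × Bool | ∀ t < m + 1, p (walk x ω t)} ⊆
      ⋃ a ∈ (Finset.univ : Finset (Fin d × Bool)),
        (fun ω : Fin m → Fin d × Bool => (Fin.cons a ω : Fin (m + 1) → Fin d × Bool)) ''
          {ω | ∀ t < m, p (walk (x + step a) ω t)} := by
    intro ω hω
    simp only [Set.mem_iUnion, Finset.mem_univ, exists_true_left]
    refine ⟨ω 0, Fin.tail ω, fun t ht => ?_, Fin.cons_self_tail ω⟩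
    rw [← walk_cons_succ, Fin.cons_self_tail]
    exact hω (t + 1) (by omega)
  have h1 := Set.ncard_le_ncard hsub
  have h2 := Finset.set_ncard_biUnion_le (Finset.univ : Finset (Fin d × Bool)) fun a =>
    (fun ω : Fin m → Fin d × Bool => (Fin.cons a ω : Fin (m + 1) → Fin d × Bool)) ''
      {ω | ∀ t < m, p (walk (x + step a) ω t)}
  have h3 := (h1.trans h2).trans (Finset.sum_le_sum fun a _ => Set.ncard_image_le)
  exact_mod_cast h3

lemma prW_forall_succ_eq_zero (d m : ℕ) (p : (Fin d → ℤ) → Prop) {x : Fin d → ℤ} (hx : ¬ p x) :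
    prW d (m + 1) {ω | ∀ t < m + 1, p (walk x ω t)} = 0 := by
  have : {ω : Fin (m + 1) → Fin d × Bool | ∀ t < m + 1, p (walk x ω t)} = ∅ := by
    ext ω
    simp only [Set.mem_ofPred_eq, Set.mem_empty_iff_false, iff_false]
    intro h
    exact hx (by simpa [walk_zero] using h 0 (Nat.succ_pos m))
  rw [prW, this, Set.ncard_empty, Nat.cast_zero, zero_div]

/-- Survival estimate: the first term controls leaving the ball of squared radius `D` before
hitting the ball of squared radius `K`, the second controls staying in between for a long time. -/
lemma prW_avoid_ball_le {K D L N : ℝ} (hK : 1 ≤ K) (hKD : K ≤ D) (hN : 0 < N) (hL : 0 < L)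
    (hLD : L ≤ log D - log (K / 4)) (m : ℕ) (hm : (m : ℝ) ≤ N) (x : Fin 2 → ℤ)
    (hx1 : 1 ≤ normSq₂ x) (hxK : K / 4 ≤ normSq₂ x) (hxD : normSq₂ x ≤ 2 * D + 2) :
    prW 2 m {ω | ∀ t < m, K < normSq₂ (walk x ω t)} ≤
      (log (2 * normSq₂ x - 1) - log (K / 4)) / L + (2 * D + 2 + N - m - normSq₂ x) / N := by
  induction m generalizing x with
  | zero =>
    have h1 : 0 ≤ (log (2 * normSq₂ x - 1) - log (K / 4)) / L :=
      div_nonneg (sub_nonneg.2 (Real.log_le_log (by linarith) (by linarith))) hL.le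
    have h2 : 1 ≤ (2 * D + 2 + N - (0 : ℕ) - normSq₂ x) / N := by
      rw [le_div_iff₀ hN]; push_cast; linarith
    linarith [prW_le_one 2 0 {ω | ∀ t < 0, K < normSq₂ (walk x ω t)}]
  | succ m ih =>
    have h1 : 0 ≤ (log (2 * normSq₂ x - 1) - log (K / 4)) / L :=
      div_nonneg (sub_nonneg.2 (Real.log_le_log (by linarith) (by linarith))) hL.le
    have h2 : 0 ≤ (2 * D + 2 + N - (m + 1 : ℕ) - normSq₂ x) / N :=
      div_nonneg (by linarith) hN.le
    by_cases hk : K < normSq₂ x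
    · by_cases hd : D ≤ normSq₂ x
      · have h3 : 1 ≤ (log (2 * normSq₂ x - 1) - log (K / 4)) / L := by
          rw [le_div_iff₀ hL]
          linarith [Real.log_le_log (by linarith : 0 < D)
            (by linarith : D ≤ 2 * normSq₂ x - 1)]
        linarith [prW_le_one 2 (m + 1) {ω | ∀ t < m + 1, K < normSq₂ (walk x ω t)}]
      · push Not at hd
        have hx : 1 < normSq₂ x := by linarith
        have hm' : (m : ℝ) ≤ N := by push_cast at hm; linarith
        refine (prW_forall_succ_le 2 m (fun y => K < normSq₂ y) x).trans ?_
        have hsum := Finset.sum_le_sum fun a (_ : a ∈ (Finset.univ : Finset (Fin 2 × Bool))) =>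
          ih hm' (x + step a) (one_le_normSq₂_add_step hx a)
            (by linarith [normSq₂_le_add_step x a, one_le_normSq₂_add_step hx a])
            (by linarith [normSq₂_add_step_le x a])
        have hsq := sum_normSq₂_add_step id x
        simp only [id] at hsq
        have hlog := sum_log_add_step_le hx
        rw [Finset.sum_add_distrib, ← Finset.sum_div, ← Finset.sum_div, Finset.sum_sub_distrib,
          Finset.sum_sub_distrib, hsq] at hsum
        simp only [Finset.sum_const, Finset.card_univ, Fintype.card_prod, Fintype.card_fin,
          Fintype.card_bool, nsmul_eq_mul] at hsum
        have h3 := div_le_div_of_nonneg_right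
          (sub_le_sub_right hlog (((2 * 2 : ℕ) : ℝ) * log (K / 4))) hL.le
        rw [div_le_iff₀ (by norm_num)]
        refine (hsum.trans (add_le_add_left h3 _)).trans (le_of_eq ?_)
        push_cast
        field_simp
        ring
    · rw [prW_forall_succ_eq_zero 2 m (fun y => K < normSq₂ y) hk]
      linarith

/-- `P_z[T_{α‖z‖} ≥ n] ≤ C / log(n/‖z‖⁴)`: the walk started at `z` fails to enter the ball
of radius `α‖z‖` within the first `n - 1` steps with at most this probability.
(`T_{α‖z‖} ≥ n` means `‖S(t)‖ > α‖z‖` for all `t < n`.) -/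
theorem hitting_shrunk_ball_tail :
    ∀ a : ℝ, 0 < a → a < 1 → ∃ C : ℝ, 0 < C ∧
      ∀ z : Fin 2 → ℤ, 1 / a ≤ eNorm z → ∀ n : ℕ, (eNorm z) ^ 4 < (n : ℝ) →
        prW 2 n {ω | ∀ t < n, a * eNorm z < eNorm (walk z ω t)} ≤
          C / Real.log ((n : ℝ) / (eNorm z) ^ 4) := by
  intro a ha0 ha1
  have ha2 : a ^ 2 < 1 := by nlinarith
  have hC : 0 < log (8 / a ^ 2) :=
    Real.log_pos (by rw [lt_div_iff₀ (by positivity)]; linarith)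
  refine ⟨2 * log (8 / a ^ 2) + 8, by linarith, fun z hz n hn => ?_⟩
  set R := eNorm z with hR
  have hK1 : 1 ≤ a * R := by
    rw [div_le_iff₀ ha0] at hz; linarith
  have hR1 : 1 < R := lt_of_lt_of_le (by rw [lt_div_iff₀ ha0]; linarith) hz
  have hset : {ω : Fin n → Fin 2 × Bool | ∀ t < n, a * R < eNorm (walk z ω t)} =
      {ω | ∀ t < n, (a * R) ^ 2 < normSq₂ (walk z ω t)} := by
    ext ω
    simp only [Set.mem_ofPred_eq, ← eNorm_sq]
    refine forall₂_congr fun t _ => ?_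
    rw [sq_lt_sq₀ (by linarith) (by unfold eNorm; exact Real.sqrt_nonneg _)]
  rw [hset]
  have hR4 : 1 < R ^ 4 := one_lt_pow₀ hR1 (by norm_num)
  have hn0 : (0 : ℝ) < n := by linarith
  have hs : √(n : ℝ) ^ 2 = n := Real.sq_sqrt hn0.le
  have hRs : R ^ 2 < √(n : ℝ) := by
    apply Real.lt_sqrt_of_sq_lt
    rw [← pow_mul]
    exact hn
  have hs1 : 1 < √(n : ℝ) := lt_trans (one_lt_pow₀ hR1 (by norm_num)) hRs
  have hX1 : 1 < (n : ℝ) / R ^ 4 := by rwa [one_lt_div (by linarith)]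
  have hl : 0 < log ((n : ℝ) / R ^ 4) := Real.log_pos hX1
  have haR : (a * R) ^ 2 ≤ R ^ 2 := by
    rw [mul_pow]; nlinarith [sq_nonneg R]
  have hlog : log ((n : ℝ) / R ^ 4) = 2 * log (√(n : ℝ)) - 2 * log (R ^ 2) := by
    rw [Real.log_div hn0.ne' (by positivity), Real.log_sqrt hn0.le, Real.log_pow, Real.log_pow]
    push_cast
    ring
  have hmain := prW_avoid_ball_le (K := (a * R) ^ 2) (D := √(n : ℝ))
    (L := log ((n : ℝ) / R ^ 4) / 2) (N := n) (one_le_pow₀ hK1) (by linarith) hn0 (by linarith)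
    (by
      have := Real.log_le_log (x := (a * R) ^ 2 / 4) (y := R ^ 2) (by positivity)
        (by linarith [sq_nonneg R])
      linarith) n le_rfl z
    (by rw [← eNorm_sq]; exact (one_lt_pow₀ hR1 (by norm_num)).le)
    (by rw [← eNorm_sq, ← hR]; linarith [sq_nonneg R])
    (by rw [← eNorm_sq, ← hR]; linarith)
  refine hmain.trans ?_
  rw [← eNorm_sq, ← hR, add_div]
  apply add_le_add
  · have h1 : log (2 * R ^ 2 - 1) - log ((a * R) ^ 2 / 4) ≤ log (8 / a ^ 2) := by
      have hR2 : 1 < R ^ 2 := one_lt_pow₀ hR1 (by norm_num)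
      rw [← Real.log_div (by linarith) (by positivity)]
      apply Real.log_le_log (div_pos (by linarith) (by positivity))
      rw [div_le_div_iff₀ (by positivity) (by positivity)]
      nlinarith [sq_nonneg a]
    rw [div_div_eq_mul_div]
    apply div_le_div_of_nonneg_right _ hl.le
    linarith
  · have h1 : log ((n : ℝ) / R ^ 4) ≤ 2 * √(n : ℝ) := by
      have := Real.log_le_sub_one_of_pos (show 0 < √(n : ℝ) by linarith)
      have := Real.log_nonneg (one_lt_pow₀ hR1 (by norm_num : (2 : ℕ) ≠ 0)).le
      linarith
    rw [div_le_div_iff₀ hn0 hl]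
    calc (2 * √(n : ℝ) + 2 + n - n - R ^ 2) * log ((n : ℝ) / R ^ 4)
        ≤ (4 * √(n : ℝ)) * log ((n : ℝ) / R ^ 4) :=
          mul_le_mul_of_nonneg_right (by linarith [sq_nonneg R]) hl.le
      _ ≤ (4 * √(n : ℝ)) * (2 * √(n : ℝ)) := mul_le_mul_of_nonneg_left h1 (by linarith)
      _ = 8 * n := by linarith
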